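/- Quadrature error for smooth kernels: let a(s,t) be smooth 2π-biperiodic, Ψ₀φ(s) = ∫₀^{2π} a(s,t)φ(t)dt and Ψ₀,Nφ(s) = ∫₀^{2π} P_N[a(s,·)φ](t)dt (equivalently the trapezoidal rule (π/N)Σ_j a(s, jπ/N)φ(jπ/N)). Then for p ≥ 0, q with p+q ≥ 1 (and p+q > 1/2), ‖(Ψ₀ - Ψ₀,N)φ‖_p ≤ C N^{-p-q} ‖φ‖_{p+q}. -/

import Mathlib

open scoped Real

/-- Sobolev norm of order `p` of a Fourier coefficient sequence. -/
noncomputable def sobNorm (p : ℝ) (c : ℤ → ℂ) : ℝ :=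
  Real.sqrt (‖c 0‖ ^ 2 + ∑' n : {n : ℤ // n ≠ 0}, |(n.1 : ℝ)| ^ (2 * p) * ‖c n.1‖ ^ 2)

/-- The `n`-th Fourier coefficient of a `2π`-periodic function. -/
noncomputable def fcoeff (f : ℝ → ℂ) (n : ℤ) : ℂ :=
  (1 / (2 * (π : ℂ))) * ∫ t in (0:ℝ)..(2 * π), f t * Complex.exp (-(Complex.I * n * t))

/-- Sobolev norm of order `p` of a `2π`-periodic function. -/
noncomputable def sobNormF (p : ℝ) (f : ℝ → ℂ) : ℝ := sobNorm p (fcoeff f)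

/-- The trigonometric monomial `t ↦ e^{int}`. -/
noncomputable def trigExp (n : ℤ) (t : ℝ) : ℂ := Complex.exp (Complex.I * n * t)

/-- The error of the trapezoidal rule with `2N` nodes on `[0, 2π]`. -/
noncomputable def trapErr (N : ℕ) (f : ℝ → ℂ) : ℂ :=
  (∫ t in (0:ℝ)..(2 * π), f t) - ((π / N : ℝ) : ℂ) * ∑ j ∈ Finset.range (2 * N), f (j * π / N)

/-- The weight `max(1, |n|)` on the integers. -/
noncomputable def freqWeight (n : ℤ) : ℝ := max 1 |(n : ℝ)|

@[fun_prop]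
theorem continuous_trigExp (n : ℤ) : Continuous (trigExp n) := by
  unfold trigExp; fun_prop

theorem norm_trigExp (n : ℤ) (t : ℝ) : ‖trigExp n t‖ = 1 := by
  unfold trigExp
  rw [show Complex.I * n * t = ((n * t : ℝ) : ℂ) * Complex.I by push_cast; ring]
  exact Complex.norm_exp_ofReal_mul_I _

theorem trigExp_add (m n : ℤ) (t : ℝ) : trigExp (m + n) t = trigExp m t * trigExp n t := by
  unfold trigExp
  rw [← Complex.exp_add]
  congr 1
  push_cast
  ring

theorem trigExp_two_pi (n : ℤ) : trigExp n (2 * π) = 1 := by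
  unfold trigExp
  rw [Complex.exp_eq_one_iff]
  exact ⟨n, by push_cast; ring⟩

theorem trigExp_zero_right (n : ℤ) : trigExp n 0 = 1 := by
  simp [trigExp]

theorem hasDerivAt_trigExp (n : ℤ) (t : ℝ) :
    HasDerivAt (trigExp n) (Complex.I * n * trigExp n t) t := by
  have h : HasDerivAt (fun t : ℝ => Complex.I * n * (t : ℂ)) (Complex.I * n) t := by
    simpa using (Complex.ofRealCLM.hasDerivAt (x := t)).const_mul (Complex.I * n)
  exact h.cexp.congr_deriv (mul_comm _ _)

theorem fcoeff_eq (f : ℝ → ℂ) (n : ℤ) :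
    fcoeff f n = (1 / (2 * (π : ℂ))) * ∫ t in (0:ℝ)..(2 * π), f t * trigExp (-n) t := by
  simp [fcoeff, trigExp]

theorem norm_fcoeff_le {f : ℝ → ℂ} {C : ℝ} (h : ∀ t ∈ Set.Icc 0 (2 * π), ‖f t‖ ≤ C) (n : ℤ) :
    ‖fcoeff f n‖ ≤ C := by
  have h2 : (0:ℝ) ≤ 2 * π := by positivity
  have := intervalIntegral.norm_integral_le_of_norm_le_const (a := (0:ℝ)) (b := 2 * π) (C := C)
    (f := fun t => f t * trigExp (-n) t) (fun t ht => by
      rw [Set.uIoc_of_le h2] at ht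
      rw [norm_mul, norm_trigExp, mul_one]
      exact h t ⟨ht.1.le, ht.2⟩)
  rw [sub_zero, abs_of_nonneg h2] at this
  rw [fcoeff_eq, norm_mul]
  have e : ‖(1 / (2 * (π : ℂ)))‖ = 1 / (2 * π) := by
    rw [show (1 / (2 * (π : ℂ))) = ((1 / (2 * π) : ℝ) : ℂ) by push_cast; rfl,
      Complex.norm_real, Real.norm_of_nonneg (by positivity)]
  rw [e, div_mul_eq_mul_div, one_mul, div_le_iff₀ (by positivity)]
  exact this

theorem integral_trigExp_of_ne {n : ℤ} (hn : n ≠ 0) :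
    ∫ t in (0:ℝ)..(2 * π), trigExp n t = 0 := by
  have h := intervalIntegral.integral_eq_sub_of_hasDerivAt (a := 0) (b := 2 * π)
    (fun t _ => hasDerivAt_trigExp n t)
    (Continuous.intervalIntegrable (by fun_prop) _ _)
  rw [intervalIntegral.integral_const_mul, trigExp_two_pi, trigExp_zero_right, sub_self] at h
  have hn' : (n : ℂ) ≠ 0 := by exact_mod_cast hn
  simpa [Complex.I_ne_zero, hn'] using h

/-- Differentiation multiplies the Fourier coefficients by `in`. -/
theorem fcoeff_deriv {f f' : ℝ → ℂ} (hf : ∀ t, HasDerivAt f (f' t) t) (hf' : Continuous f')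
    (hper : f (2 * π) = f 0) (n : ℤ) : fcoeff f' n = Complex.I * n * fcoeff f n := by
  have h := intervalIntegral.integral_deriv_mul_eq_sub (a := 0) (b := 2 * π)
    (fun t _ => hf t) (fun t _ => hasDerivAt_trigExp (-n) t)
    (hf'.intervalIntegrable _ _) (Continuous.intervalIntegrable (by fun_prop) _ _)
  have hfc : Continuous f := continuous_iff_continuousAt.2 fun t => (hf t).continuousAt
  rw [trigExp_two_pi, trigExp_zero_right, hper, sub_self, intervalIntegral.integral_add
    (Continuous.intervalIntegrable (by fun_prop) _ _)
    (Continuous.intervalIntegrable (by fun_prop) _ _)] at h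
  simp_rw [fun x => mul_left_comm (f x)] at h
  rw [intervalIntegral.integral_const_mul] at h
  rw [fcoeff_eq, fcoeff_eq, eq_neg_of_add_eq_zero_left h]
  push_cast
  ring

/-- Pointwise convergence of absolutely convergent Fourier series. -/
theorem hasSum_fcoeff_mul_trigExp {f : ℝ → ℂ} (hf : Continuous f)
    (hper : Function.Periodic f (2 * π)) (hs : Summable (fcoeff f)) (t : ℝ) :
    HasSum (fun n => fcoeff f n * trigExp n t) (f t) := by
  have : Fact (0 < 2 * π) := ⟨by positivity⟩
  have hpi : (π : ℂ) ≠ 0 := by exact_mod_cast Real.pi_ne_zero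
  have hexp : ∀ (n : ℤ) (x : ℝ), fourier n (x : AddCircle (2 * π)) = trigExp n x := by
    intro n x
    rw [fourier_coe_apply, trigExp]
    congr 1
    push_cast
    field_simp
  let g : C(AddCircle (2 * π), ℂ) := ⟨hper.lift, hf.quotient_lift _⟩
  have hg : ∀ x : ℝ, g (x : AddCircle (2 * π)) = f x := fun x => rfl
  have hc : fourierCoeff g = fcoeff f := by
    ext n
    rw [fourierCoeff_eq_intervalIntegral _ n 0, fcoeff_eq, zero_add, Complex.real_smul]
    push_cast
    congr 1
    refine intervalIntegral.integral_congr fun x _ => ?_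
    simp only [hexp, hg, smul_eq_mul, mul_comm]
  have h := has_pointwise_sum_fourier_series_of_summable (f := g) (by rwa [hc]) t
  simpa only [hc, hexp, hg, smul_eq_mul] using h

theorem sum_trigExp_nodes {N : ℕ} (hN : 0 < N) {n : ℤ} (hn : ¬ (2 * N : ℤ) ∣ n) :
    ∑ j ∈ Finset.range (2 * N), trigExp n (j * π / N) = 0 := by
  have hN' : (N : ℂ) ≠ 0 := by exact_mod_cast hN.ne'
  have hpi : (π : ℂ) ≠ 0 := by exact_mod_cast Real.pi_ne_zero
  set z := trigExp n (π / N) with hz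
  have hpow : ∀ j : ℕ, trigExp n (j * π / N) = z ^ j := by
    intro j
    rw [hz, trigExp, trigExp, ← Complex.exp_nat_mul]
    congr 1
    push_cast
    ring
  have hz1 : z ≠ 1 := by
    rw [hz, trigExp, Ne, Complex.exp_eq_one_iff]
    rintro ⟨k, hk⟩
    apply hn
    refine ⟨k, ?_⟩
    have : (n : ℂ) = 2 * N * k := by
      push_cast at hk
      have h3 : Complex.I * π * (n - 2 * N * k) = 0 := by
        field_simp at hk
        linear_combination Complex.I * π * hk
      simpa [Complex.I_ne_zero, hpi, sub_eq_zero] using h3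
    exact_mod_cast this
  simp_rw [hpow]
  rw [geom_sum_eq hz1, ← hpow]
  have : ((2 * N : ℕ) : ℝ) * π / N = 2 * π := by
    have : (N : ℝ) ≠ 0 := by exact_mod_cast hN.ne'
    push_cast
    field_simp
  rw [this, trigExp_two_pi, sub_self, zero_div]

open Classical in
theorem norm_trapErr_trigExp_le {N : ℕ} (hN : 0 < N) (n : ℤ) :
    ‖trapErr N (trigExp n)‖ ≤ if (2 * N : ℤ) ∣ n ∧ n ≠ 0 then 2 * π else 0 := by
  have hN' : (N : ℂ) ≠ 0 := by exact_mod_cast hN.ne'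
  by_cases h0 : n = 0
  · subst h0
    have h1 : ∀ t, trigExp 0 t = 1 := fun t => by simp [trigExp]
    have : trapErr N (trigExp 0) = 0 := by
      simp only [trapErr, h1]
      simp
      field_simp
      ring
    simp [this]
  · by_cases hd : (2 * N : ℤ) ∣ n
    · rw [if_pos ⟨hd, h0⟩, trapErr, integral_trigExp_of_ne h0, zero_sub, norm_neg, norm_mul,
        Complex.norm_real, Real.norm_of_nonneg (by positivity)]
      have h2 : ‖∑ j ∈ Finset.range (2 * N), trigExp n (j * π / N)‖ ≤ 2 * N := by
        refine (norm_sum_le _ _).trans ?_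
        simp [norm_trigExp]
      calc π / N * ‖∑ j ∈ Finset.range (2 * N), trigExp n (j * π / N)‖
          ≤ π / N * (2 * N) := by gcongr
        _ = 2 * π := by
          have : (N : ℝ) ≠ 0 := by exact_mod_cast hN.ne'
          field_simp
    · rw [if_neg (fun h => hd h.1), trapErr, integral_trigExp_of_ne h0, sum_trigExp_nodes hN hd]
      simp

/-- The trapezoidal error is continuous along dominated series. -/
theorem hasSum_trapErr {ι : Type*} [Countable ι] (N : ℕ) {F : ι → ℝ → ℂ} {f : ℝ → ℂ} {u : ι → ℝ}
    (hF : ∀ i, Continuous (F i)) (hu : Summable u) (hb : ∀ i t, ‖F i t‖ ≤ u i)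
    (hsum : ∀ t, HasSum (fun i => F i t) (f t)) :
    HasSum (fun i => trapErr N (F i)) (trapErr N f) := by
  unfold trapErr
  refine HasSum.sub ?_ (HasSum.mul_left _ (hasSum_sum fun j _ => hsum _))
  exact intervalIntegral.hasSum_integral_of_dominated_convergence (fun i _ => u i)
    (fun i => (hF i).aestronglyMeasurable) (fun i => .of_forall fun t _ => hb i t)
    (.of_forall fun _ _ => hu) intervalIntegrable_const (.of_forall fun t _ => hsum t)

theorem trapErr_const_mul (N : ℕ) (c : ℂ) (f : ℝ → ℂ) :
    trapErr N (fun t => c * f t) = c * trapErr N f := by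
  unfold trapErr
  rw [intervalIntegral.integral_const_mul, ← Finset.mul_sum]
  ring

theorem one_le_freqWeight (n : ℤ) : 1 ≤ freqWeight n := le_max_left _ _

theorem freqWeight_pos (n : ℤ) : 0 < freqWeight n := one_pos.trans_le (one_le_freqWeight n)

theorem freqWeight_of_ne {n : ℤ} (hn : n ≠ 0) : freqWeight n = |(n : ℝ)| :=
  max_eq_right (by exact_mod_cast Int.one_le_abs hn)

theorem freqWeight_zero : freqWeight 0 = 1 := by simp [freqWeight]

theorem abs_add_le_freqWeight (j k : ℤ) :
    |((j + k : ℤ) : ℝ)| ≤ 2 * freqWeight j * freqWeight k := by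
  have h1 : |(j : ℝ)| ≤ freqWeight j := le_max_right _ _
  have h2 : |(k : ℝ)| ≤ freqWeight k := le_max_right _ _
  have h3 := one_le_freqWeight j
  have h4 := one_le_freqWeight k
  push_cast
  refine (abs_add_le _ _).trans ?_
  nlinarith

theorem summable_freqWeight_rpow {b : ℝ} (hb : 1 < b) :
    Summable fun n : ℤ => freqWeight n ^ (-b) := by
  refine (Real.summable_abs_int_rpow hb).congr_cofinite ?_
  filter_upwards [(Set.finite_singleton (0 : ℤ)).compl_mem_cofinite] with n hn
  rw [freqWeight_of_ne hn]

theorem summable_mul_and_tsum_mul_le_sqrt {ι : Type*} {f g : ι → ℝ} (hf0 : ∀ i, 0 ≤ f i)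
    (hg0 : ∀ i, 0 ≤ g i) (hf : Summable fun i => f i ^ 2) (hg : Summable fun i => g i ^ 2) :
    (Summable fun i => f i * g i) ∧
      ∑' i, f i * g i ≤ √(∑' i, f i ^ 2) * √(∑' i, g i ^ 2) := by
  have h := Real.summable_and_inner_le_Lp_mul_Lq_tsum_of_nonneg (p := 2) (q := 2)
    Real.HolderConjugate.two_two hf0 hg0 (by simpa using hf) (by simpa using hg)
  simpa [Real.sqrt_eq_rpow] using h

theorem summable_freqWeight_mul_sq {r : ℝ} {c : ℤ → ℂ}
    (h : Summable (fun n : {n : ℤ // n ≠ 0} => |(n.1 : ℝ)| ^ (2 * r) * ‖c n.1‖ ^ 2)) :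
    Summable fun n : ℤ => (freqWeight n ^ r * ‖c n‖) ^ 2 := by
  have hs : Summable
      ((fun n : ℤ => (freqWeight n ^ r * ‖c n‖) ^ 2) ∘ ((↑) : ({0}ᶜ : Set ℤ) → ℤ)) := by
    refine Summable.congr (f := fun n : {n : ℤ // n ≠ 0} =>
      |(n.1 : ℝ)| ^ (2 * r) * ‖c n.1‖ ^ 2) h fun n => ?_
    change |(n.1 : ℝ)| ^ (2 * r) * ‖c n.1‖ ^ 2 = (freqWeight n.1 ^ r * ‖c n.1‖) ^ 2
    rw [freqWeight_of_ne n.2, mul_pow, ← Real.rpow_mul_natCast (abs_nonneg _),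
      mul_comm 2 r]
    norm_num
  exact ((Set.finite_singleton (0 : ℤ)).summable_compl_iff).1 hs

theorem sobNorm_eq {r : ℝ} {c : ℤ → ℂ}
    (h : Summable fun n : ℤ => (freqWeight n ^ r * ‖c n‖) ^ 2) :
    sobNorm r c = √(∑' n : ℤ, (freqWeight n ^ r * ‖c n‖) ^ 2) := by
  rw [sobNorm, ← h.tsum_subtype_add_tsum_subtype_compl {0}, tsum_singleton 0
    (fun n : ℤ => (freqWeight n ^ r * ‖c n‖) ^ 2), freqWeight_zero, Real.one_rpow, one_mul]
  congr 2
  refine tsum_congr fun n : {n : ℤ // n ≠ 0} => ?_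
  rw [freqWeight_of_ne n.2, mul_pow, ← Real.rpow_mul_natCast (abs_nonneg _), mul_comm 2 r]
  norm_num

theorem sobNorm_le_of_norm_le {p D : ℝ} (hD : 0 ≤ D) {c : ℤ → ℂ}
    (h : ∀ n, ‖c n‖ ≤ D * freqWeight n ^ (-(p + 1))) :
    sobNorm p c ≤ D * √(∑' n : ℤ, freqWeight n ^ (-2 : ℝ)) := by
  have hb : ∀ n, (freqWeight n ^ p * ‖c n‖) ^ 2 ≤ D ^ 2 * freqWeight n ^ (-2 : ℝ) := by
    intro n
    have h1 : freqWeight n ^ p * ‖c n‖ ≤ D * freqWeight n ^ (-1 : ℝ) := by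
      calc freqWeight n ^ p * ‖c n‖
          ≤ freqWeight n ^ p * (D * freqWeight n ^ (-(p + 1))) := by
            gcongr
            · exact (Real.rpow_pos_of_pos (freqWeight_pos n) _).le
            · exact h n
        _ = D * (freqWeight n ^ p * freqWeight n ^ (-(p + 1))) := by ring
        _ = D * freqWeight n ^ (-1 : ℝ) := by
          rw [← Real.rpow_add (freqWeight_pos n)]
          ring_nf
    calc (freqWeight n ^ p * ‖c n‖) ^ 2 ≤ (D * freqWeight n ^ (-1 : ℝ)) ^ 2 :=
          pow_le_pow_left₀ (mul_nonneg (Real.rpow_pos_of_pos (freqWeight_pos n) _).le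
            (norm_nonneg _)) h1 2
      _ = D ^ 2 * freqWeight n ^ (-2 : ℝ) := by
          rw [mul_pow, ← Real.rpow_mul_natCast (freqWeight_pos n).le]
          norm_num
  have hs : Summable fun n : ℤ => D ^ 2 * freqWeight n ^ (-2 : ℝ) :=
    (summable_freqWeight_rpow one_lt_two).mul_left _
  have hs' := Summable.of_nonneg_of_le (fun n => sq_nonneg _) hb hs
  rw [sobNorm_eq hs']
  calc √(∑' n : ℤ, (freqWeight n ^ p * ‖c n‖) ^ 2)
      ≤ √(∑' n : ℤ, D ^ 2 * freqWeight n ^ (-2 : ℝ)) :=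
        Real.sqrt_le_sqrt (hs'.tsum_le_tsum hb hs)
    _ = D * √(∑' n : ℤ, freqWeight n ^ (-2 : ℝ)) := by
      rw [tsum_mul_left, Real.sqrt_mul (sq_nonneg _), Real.sqrt_sq hD]

open Classical in
/-- The restriction of `|n|^{-r}` to the nonzero multiples of `2N`. -/
noncomputable def aliasWeight (N : ℕ) (r : ℝ) (n : ℤ) : ℝ :=
  if (2 * N : ℤ) ∣ n ∧ n ≠ 0 then |(n : ℝ)| ^ (-r) else 0

theorem aliasWeight_nonneg (N : ℕ) (r : ℝ) (n : ℤ) : 0 ≤ aliasWeight N r n := by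
  unfold aliasWeight
  split_ifs <;> positivity

theorem hasSum_aliasWeight_sq {N : ℕ} (hN : 0 < N) {r : ℝ} (hr : 1 / 2 < r) :
    HasSum (fun n => aliasWeight N r n ^ 2)
      ((2 * N : ℝ) ^ (-(2 * r)) * ∑' l : ℤ, |(l : ℝ)| ^ (-(2 * r))) := by
  have hinj : Function.Injective fun l : ℤ => 2 * (N : ℤ) * l :=
    mul_right_injective₀ (by positivity)
  have hsupp : ∀ n ∉ Set.range (fun l : ℤ => 2 * (N : ℤ) * l), aliasWeight N r n ^ 2 = 0 := by
    intro n hn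
    have : ¬ ((2 * N : ℤ) ∣ n ∧ n ≠ 0) := fun ⟨⟨l, hl⟩, _⟩ => hn ⟨l, hl.symm⟩
    rw [aliasWeight, if_neg this]
    norm_num
  rw [← hinj.hasSum_iff hsupp]
  have hs := (Real.summable_abs_int_rpow (b := 2 * r) (by linarith)).hasSum.mul_left
    ((2 * N : ℝ) ^ (-(2 * r)))
  suffices h : (fun n => aliasWeight N r n ^ 2) ∘ (fun l : ℤ => 2 * (N : ℤ) * l) =
      fun l : ℤ => (2 * N : ℝ) ^ (-(2 * r)) * |(l : ℝ)| ^ (-(2 * r)) by rwa [h]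
  funext l
  rw [Function.comp_apply, aliasWeight]
  by_cases hl : l = 0
  · subst hl
    simp [Real.zero_rpow (show -(2 * r) ≠ 0 by linarith)]
  · rw [if_pos ⟨⟨l, rfl⟩, by positivity⟩, ← Real.rpow_mul_natCast (abs_nonneg _)]
    push_cast
    rw [abs_mul, abs_of_nonneg (show (0:ℝ) ≤ 2 * N by positivity),
      Real.mul_rpow (by positivity) (abs_nonneg _)]
    ring_nf

theorem summable_norm_of_summable_sobolev {r : ℝ} (hr : 1 / 2 < r) {c : ℤ → ℂ}
    (h : Summable fun n : ℤ => (freqWeight n ^ r * ‖c n‖) ^ 2) : Summable fun n => ‖c n‖ := by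
  have hw : ∀ (n : ℤ) (s : ℝ), 0 ≤ freqWeight n ^ s := fun n s =>
    (Real.rpow_pos_of_pos (freqWeight_pos n) s).le
  have h1 : Summable fun n : ℤ => (freqWeight n ^ (-r)) ^ 2 := by
    refine (summable_freqWeight_rpow (b := 2 * r) (by linarith)).congr fun n => ?_
    rw [← Real.rpow_mul_natCast (freqWeight_pos n).le]
    ring_nf
  refine (summable_mul_and_tsum_mul_le_sqrt (fun n => hw n _)
    (fun n => mul_nonneg (hw n _) (norm_nonneg _)) h1 h).1.congr fun n => ?_
  rw [← mul_assoc, ← Real.rpow_add (freqWeight_pos n), neg_add_cancel, Real.rpow_zero, one_mul]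

/-- The trapezoidal error of `e^{ijt} φ(t)` for `φ` in the Sobolev space of order `r > 1/2`. -/
theorem norm_trapErr_trigExp_mul_le {r : ℝ} (hr : 1 / 2 < r) {N : ℕ} (hN : 0 < N) {φ : ℝ → ℂ}
    (hφ : Continuous φ) (hper : Function.Periodic φ (2 * π))
    (hs : Summable fun n : ℤ => (freqWeight n ^ r * ‖fcoeff φ n‖) ^ 2) (j : ℤ) :
    ‖trapErr N (fun t => trigExp j t * φ t)‖ ≤
      2 * π * √(∑' l : ℤ, |(l : ℝ)| ^ (-(2 * r))) * freqWeight j ^ r *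
        ((N : ℝ) ^ (-r) * sobNormF r φ) := by
  have hw : ∀ (n : ℤ) (s : ℝ), 0 < freqWeight n ^ s := fun n s =>
    Real.rpow_pos_of_pos (freqWeight_pos n) s
  have hsum := summable_norm_of_summable_sobolev hr hs
  have hE := hasSum_trapErr N (F := fun k t => fcoeff φ k * trigExp (j + k) t)
    (f := fun t => trigExp j t * φ t) (fun k => by fun_prop) hsum
    (fun k t => by rw [norm_mul, norm_trigExp, mul_one]) (fun t => by
      simp_rw [trigExp_add, fun k => mul_left_comm (fcoeff φ k)]
      exact (hasSum_fcoeff_mul_trigExp hφ hper hsum.of_norm t).mul_left _)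
  set y : ℤ → ℝ := fun k => freqWeight k ^ r * ‖fcoeff φ k‖ with hy
  have hb : ∀ k, ‖trapErr N (fun t => fcoeff φ k * trigExp (j + k) t)‖ ≤
      2 * π * (2 * freqWeight j) ^ r * (aliasWeight N r (j + k) * y k) := by
    intro k
    rw [trapErr_const_mul, norm_mul]
    have h1 := norm_trapErr_trigExp_le hN (j + k)
    unfold aliasWeight
    split_ifs at h1 ⊢ with hc
    · have hpos : 0 < |((j + k : ℤ) : ℝ)| := abs_pos.2 (by exact_mod_cast hc.2)
      have h2 : |((j + k : ℤ) : ℝ)| ^ r ≤ (2 * freqWeight j) ^ r * freqWeight k ^ r := by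
        rw [← Real.mul_rpow (by linarith [freqWeight_pos j]) (freqWeight_pos k).le]
        exact Real.rpow_le_rpow hpos.le (abs_add_le_freqWeight j k) (by linarith)
      have h3 : 1 ≤ (2 * freqWeight j) ^ r * freqWeight k ^ r * |((j + k : ℤ) : ℝ)| ^ (-r) := by
        rw [Real.rpow_neg hpos.le, ← div_eq_mul_inv, one_le_div (Real.rpow_pos_of_pos hpos r)]
        exact h2
      calc ‖fcoeff φ k‖ * ‖trapErr N (trigExp (j + k))‖ ≤ ‖fcoeff φ k‖ * (2 * π) := by gcongr
        _ ≤ ‖fcoeff φ k‖ * (2 * π) *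
            ((2 * freqWeight j) ^ r * freqWeight k ^ r * |((j + k : ℤ) : ℝ)| ^ (-r)) :=
          le_mul_of_one_le_right (by positivity) h3
        _ = _ := by rw [hy]; ring
    · rw [le_antisymm h1 (norm_nonneg _)]
      simp
  have hA := hasSum_aliasWeight_sq hN hr
  have hA' : HasSum (fun k => aliasWeight N r (j + k) ^ 2)
      ((2 * N : ℝ) ^ (-(2 * r)) * ∑' l : ℤ, |(l : ℝ)| ^ (-(2 * r))) :=
    ((Equiv.addLeft j).hasSum_iff (f := fun n => aliasWeight N r n ^ 2)).2 hA
  obtain ⟨hm, hle⟩ := summable_mul_and_tsum_mul_le_sqrt (fun k => aliasWeight_nonneg N r (j + k))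
    (fun k => mul_nonneg (hw k r).le (norm_nonneg (fcoeff φ k))) hA'.summable hs
  rw [hA'.tsum_eq] at hle
  rw [← hE.tsum_eq]
  refine (tsum_of_norm_bounded (hm.hasSum.mul_left _) hb).trans ?_
  have h2N : √((2 * N : ℝ) ^ (-(2 * r))) = (2 : ℝ) ^ (-r) * (N : ℝ) ^ (-r) := by
    rw [← Real.mul_rpow zero_le_two (Nat.cast_nonneg N), show -(2 * r) = -r * (2 : ℕ) by
      push_cast; ring, Real.rpow_mul_natCast (by positivity),
      Real.sqrt_sq (Real.rpow_nonneg (by positivity) _)]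
  rw [sobNormF, sobNorm_eq hs]
  rw [Real.sqrt_mul (by positivity), h2N] at hle
  have h22 : (2 : ℝ) ^ r * 2 ^ (-r) = 1 := by
    rw [← Real.rpow_add two_pos, add_neg_cancel, Real.rpow_zero]
  have hj := (hw j r).le
  have h2j : (0:ℝ) ≤ (2 * freqWeight j) ^ r :=
    Real.rpow_nonneg (by linarith [freqWeight_pos j]) _
  refine (mul_le_mul_of_nonneg_left hle (mul_nonneg (by positivity) h2j)).trans_eq ?_
  rw [Real.mul_rpow two_pos.le (freqWeight_pos j).le]
  generalize √(∑' l : ℤ, |(l : ℝ)| ^ (-(2 * r))) = Z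
  generalize √(∑' n : ℤ, (freqWeight n ^ r * ‖fcoeff φ n‖) ^ 2) = Y
  linear_combination (2 * π * Z * freqWeight j ^ r * ((N : ℝ) ^ (-r) * Y)) * h22

/-- Smooth kernels that are `2π`-periodic in both variables. -/
structure IsSmoothBiperiodic (a : ℝ → ℝ → ℂ) : Prop where
  contDiff : ContDiff ℝ (⊤ : ℕ∞) (fun st : ℝ × ℝ => a st.1 st.2)
  periodic_left : ∀ s t : ℝ, a (s + 2 * π) t = a s t
  periodic_right : ∀ s t : ℝ, a s (t + 2 * π) = a s t

/-- The double Fourier coefficients of a kernel. -/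
noncomputable def kernelCoeff (a : ℝ → ℝ → ℂ) (m j : ℤ) : ℂ :=
  fcoeff (fun t => fcoeff (fun s => a s t) m) j

theorem intervalIntegral_swap_of_continuous {F : ℝ → ℝ → ℂ}
    (hF : Continuous fun st : ℝ × ℝ => F st.1 st.2) (a b c d : ℝ) :
    ∫ x in a..b, ∫ y in c..d, F x y = ∫ y in c..d, ∫ x in a..b, F x y := by
  refine MeasureTheory.intervalIntegral_intervalIntegral_swap ?_
  exact (hF.continuousOn.integrableOn_compact (isCompact_uIcc.prod isCompact_uIcc)).mono_set
    (Set.prod_mono Set.uIoc_subset_uIcc Set.uIoc_subset_uIcc)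

theorem continuous_fcoeff {a : ℝ → ℝ → ℂ} (ha : Continuous fun st : ℝ × ℝ => a st.1 st.2)
    (m : ℤ) : Continuous fun t => fcoeff (fun s => a s t) m := by
  simp_rw [fcoeff_eq]
  refine continuous_const.mul ?_
  refine intervalIntegral.continuous_parametric_intervalIntegral_of_continuous
    (f := fun t s => a s t * trigExp (-m) s) ?_ continuous_const
  exact (ha.comp (continuous_snd.prodMk continuous_fst)).mul
    ((continuous_trigExp _).comp continuous_snd)

theorem kernelCoeff_swap {a : ℝ → ℝ → ℂ} (ha : Continuous fun st : ℝ × ℝ => a st.1 st.2)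
    (m j : ℤ) : kernelCoeff (fun s t => a t s) m j = kernelCoeff a j m := by
  have h := intervalIntegral_swap_of_continuous
    (F := fun s t => a s t * trigExp (-j) s * trigExp (-m) t)
    ((ha.mul ((continuous_trigExp _).comp continuous_fst)).mul
      ((continuous_trigExp _).comp continuous_snd)) 0 (2 * π) 0 (2 * π)
  simp only [kernelCoeff, fcoeff_eq]
  simp only [mul_assoc, intervalIntegral.integral_const_mul]
  congr 2
  simp only [← intervalIntegral.integral_mul_const]
  refine Eq.trans (intervalIntegral.integral_congr fun s _ =>
    intervalIntegral.integral_congr fun t _ => ?_) h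
  exact mul_right_comm _ _ _

namespace IsSmoothBiperiodic

variable {a : ℝ → ℝ → ℂ}

theorem continuous (h : IsSmoothBiperiodic a) : Continuous fun st : ℝ × ℝ => a st.1 st.2 :=
  h.contDiff.continuous

theorem swap (h : IsSmoothBiperiodic a) : IsSmoothBiperiodic fun s t => a t s where
  contDiff := h.contDiff.comp (contDiff_snd.prodMk contDiff_fst)
  periodic_left s t := h.periodic_right t s
  periodic_right s t := h.periodic_left t s

theorem exists_deriv_left (h : IsSmoothBiperiodic a) : ∃ b, IsSmoothBiperiodic b ∧
    ∀ m j, kernelCoeff b m j = Complex.I * m * kernelCoeff a m j := by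
  set b : ℝ → ℝ → ℂ := fun s t => fderiv ℝ (fun st : ℝ × ℝ => a st.1 st.2) (s, t) (1, 0) with hb
  have hder : ∀ s t, HasDerivAt (fun s => a s t) (b s t) s := by
    intro s t
    have h1 := (h.contDiff.differentiable (by simp) (s, t)).hasFDerivAt
    have h2 : HasDerivAt (fun s : ℝ => (s, t)) ((1 : ℝ), (0 : ℝ)) s :=
      (hasDerivAt_id s).prodMk (hasDerivAt_const s t)
    exact h1.comp_hasDerivAt s h2
  have hsmooth : ContDiff ℝ (⊤ : ℕ∞) fun st : ℝ × ℝ => b st.1 st.2 :=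
    (h.contDiff.fderiv_right (by simp)).clm_apply contDiff_const
  have hbper : IsSmoothBiperiodic b := by
    refine ⟨hsmooth, fun s t => ?_, fun s t => ?_⟩
    · have h1 := (hder (s + 2 * π) t).comp_add_const s (2 * π)
      simp only [h.periodic_left] at h1
      exact h1.unique (hder s t)
    · have h1 := hder s (t + 2 * π)
      simp only [h.periodic_right] at h1
      exact h1.unique (hder s t)
  refine ⟨b, hbper, fun m j => ?_⟩
  have hcoeff : ∀ t, fcoeff (fun s => b s t) m = Complex.I * m * fcoeff (fun s => a s t) m :=
    fun t => fcoeff_deriv (fun s => hder s t)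
      (hbper.continuous.comp (continuous_id.prodMk continuous_const))
      (by simpa using h.periodic_left 0 t) m
  simp only [kernelCoeff, hcoeff]
  rw [fcoeff_eq, fcoeff_eq]
  simp only [mul_assoc, intervalIntegral.integral_const_mul]
  ring

theorem exists_deriv_right (h : IsSmoothBiperiodic a) : ∃ b, IsSmoothBiperiodic b ∧
    ∀ m j, kernelCoeff b m j = Complex.I * j * kernelCoeff a m j := by
  obtain ⟨b, hb, hk⟩ := h.swap.exists_deriv_left
  refine ⟨_, hb.swap, fun m j => ?_⟩
  rw [kernelCoeff_swap hb.continuous, hk, kernelCoeff_swap h.continuous]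

theorem exists_iterated_deriv (h : IsSmoothBiperiodic a) (k l : ℕ) :
    ∃ b, IsSmoothBiperiodic b ∧ ∀ m j : ℤ,
      kernelCoeff b m j = (Complex.I * m) ^ k * (Complex.I * j) ^ l * kernelCoeff a m j := by
  induction k with
  | zero =>
    induction l with
    | zero => exact ⟨a, h, fun m j => by simp⟩
    | succ l ih =>
      obtain ⟨b, hb, hk⟩ := ih
      obtain ⟨c, hc, hk'⟩ := hb.exists_deriv_right
      exact ⟨c, hc, fun m j => by rw [hk', hk]; ring⟩
  | succ k ih =>
    obtain ⟨b, hb, hk⟩ := ih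
    obtain ⟨c, hc, hk'⟩ := hb.exists_deriv_left
    exact ⟨c, hc, fun m j => by rw [hk', hk]; ring⟩

theorem exists_norm_kernelCoeff_le (h : IsSmoothBiperiodic a) :
    ∃ C, ∀ m j, ‖kernelCoeff a m j‖ ≤ C := by
  obtain ⟨C, hC⟩ := ((isCompact_Icc (a := (0:ℝ)) (b := 2 * π)).prod
    (isCompact_Icc (a := (0:ℝ)) (b := 2 * π))).exists_bound_of_continuousOn
    h.continuous.continuousOn
  exact ⟨C, fun m j => norm_fcoeff_le (fun t ht => norm_fcoeff_le
    (fun s hs => hC (s, t) ⟨hs, ht⟩) m) j⟩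

theorem exists_norm_pow_mul_kernelCoeff_le (h : IsSmoothBiperiodic a) (k l : ℕ) :
    ∃ C, ∀ m j : ℤ, |(m : ℝ)| ^ k * |(j : ℝ)| ^ l * ‖kernelCoeff a m j‖ ≤ C := by
  obtain ⟨b, hb, hk⟩ := h.exists_iterated_deriv k l
  obtain ⟨C, hC⟩ := hb.exists_norm_kernelCoeff_le
  refine ⟨C, fun m j => ?_⟩
  have := hC m j
  rw [hk] at this
  simpa [Complex.norm_intCast] using this

/-- Rapid decay of the double Fourier coefficients of a smooth kernel. -/
theorem exists_norm_kernelCoeff_le_rpow (h : IsSmoothBiperiodic a) (α β : ℝ) :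
    ∃ C, 0 ≤ C ∧ ∀ m j : ℤ,
      ‖kernelCoeff a m j‖ ≤ C * (freqWeight m ^ (-α) * freqWeight j ^ (-β)) := by
  set k := ⌈α⌉₊
  set l := ⌈β⌉₊
  obtain ⟨C₀₀, h₀₀⟩ := h.exists_norm_pow_mul_kernelCoeff_le 0 0
  obtain ⟨C₁₀, h₁₀⟩ := h.exists_norm_pow_mul_kernelCoeff_le k 0
  obtain ⟨C₀₁, h₀₁⟩ := h.exists_norm_pow_mul_kernelCoeff_le 0 l
  obtain ⟨C₁₁, h₁₁⟩ := h.exists_norm_pow_mul_kernelCoeff_le k l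
  set C := |C₀₀| + |C₁₀| + |C₀₁| + |C₁₁| with hC
  have hC0 : 0 ≤ C := by positivity
  refine ⟨C, hC0, fun m j => ?_⟩
  have key : freqWeight m ^ k * freqWeight j ^ l * ‖kernelCoeff a m j‖ ≤ C := by
    have e₀₀ := (h₀₀ m j).trans (le_abs_self _)
    have e₁₀ := (h₁₀ m j).trans (le_abs_self _)
    have e₀₁ := (h₀₁ m j).trans (le_abs_self _)
    have e₁₁ := (h₁₁ m j).trans (le_abs_self _)
    have p₀₀ := abs_nonneg C₀₀
    have p₁₀ := abs_nonneg C₁₀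
    have p₀₁ := abs_nonneg C₀₁
    have p₁₁ := abs_nonneg C₁₁
    by_cases hm : m = 0 <;> by_cases hj : j = 0
    · simp only [hm, hj, freqWeight_zero, one_pow, pow_zero] at *
      linarith
    · simp only [hm, freqWeight_zero, freqWeight_of_ne hj, one_pow, pow_zero] at *
      linarith
    · simp only [hj, freqWeight_zero, freqWeight_of_ne hm, one_pow, pow_zero] at *
      linarith
    · rw [freqWeight_of_ne hm, freqWeight_of_ne hj]
      linarith
  have hle : ∀ (n : ℤ) (x : ℝ), freqWeight n ^ x ≤ freqWeight n ^ ⌈x⌉₊ := fun n x => by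
    rw [← Real.rpow_natCast]
    exact Real.rpow_le_rpow_of_exponent_le (one_le_freqWeight n) (Nat.le_ceil x)
  have hm := Real.rpow_pos_of_pos (freqWeight_pos m) α
  have hj := Real.rpow_pos_of_pos (freqWeight_pos j) β
  rw [Real.rpow_neg (freqWeight_pos m).le, Real.rpow_neg (freqWeight_pos j).le, ← mul_inv,
    ← div_eq_mul_inv, le_div_iff₀ (mul_pos hm hj), mul_comm]
  refine le_trans ?_ key
  exact mul_le_mul_of_nonneg_right (mul_le_mul (hle m α) (hle j β) hj.le
    (hm.le.trans (hle m α))) (norm_nonneg _)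

end IsSmoothBiperiodic

/-- The Fourier coefficients of the quadrature error of an integral operator. -/
theorem fcoeff_quadrature_error {a : ℝ → ℝ → ℂ}
    (ha : Continuous fun st : ℝ × ℝ => a st.1 st.2) {φ : ℝ → ℂ} (hφ : Continuous φ) (N : ℕ)
    (m : ℤ) :
    fcoeff (fun s => trapErr N fun t => a s t * φ t) m =
      trapErr N fun t => fcoeff (fun s => a s t) m * φ t := by
  have hc : ∀ t, Continuous fun s => a s t := fun t =>
    ha.comp (continuous_id.prodMk continuous_const)
  have hi : Continuous fun s => ∫ t in (0:ℝ)..(2 * π), a s t * φ t :=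
    intervalIntegral.continuous_parametric_intervalIntegral_of_continuous
      (f := fun s t => a s t * φ t) (ha.mul (hφ.comp continuous_snd)) continuous_const
  have h := intervalIntegral_swap_of_continuous
    (F := fun s t => a s t * φ t * trigExp (-m) s)
    ((ha.mul (hφ.comp continuous_snd)).mul ((continuous_trigExp _).comp continuous_fst))
    0 (2 * π) 0 (2 * π)
  simp only [intervalIntegral.integral_mul_const] at h
  have hsum : ∫ s in (0:ℝ)..(2 * π), (∑ j ∈ Finset.range (2 * N),
      a s (j * π / N) * φ (j * π / N)) * trigExp (-m) s = ∑ j ∈ Finset.range (2 * N),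
      (∫ s in (0:ℝ)..(2 * π), a s (j * π / N) * trigExp (-m) s) * φ (j * π / N) := by
    simp only [Finset.sum_mul]
    rw [intervalIntegral.integral_finsetSum]
    swap
    · exact fun j _ =>
        (((hc _).mul continuous_const).mul (continuous_trigExp _)).intervalIntegrable _ _
    refine Finset.sum_congr rfl fun j _ => ?_
    rw [← intervalIntegral.integral_mul_const]
    simp only [mul_right_comm]
  have hsc : Continuous fun s => ∑ j ∈ Finset.range (2 * N), a s (j * π / N) * φ (j * π / N) :=
    continuous_finsetSum _ fun j _ => (hc _).mul continuous_const
  simp only [trapErr, fcoeff_eq, sub_mul]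
  rw [intervalIntegral.integral_sub (Continuous.intervalIntegrable (by fun_prop) _ _)
    (Continuous.intervalIntegrable (by fun_prop) _ _), h]
  simp only [mul_assoc, intervalIntegral.integral_const_mul] at hsum ⊢
  rw [hsum, ← Finset.mul_sum]
  have hcomm : ∀ t, ∫ s in (0:ℝ)..(2 * π), a s t * (φ t * trigExp (-m) s) =
      (∫ s in (0:ℝ)..(2 * π), a s t * trigExp (-m) s) * φ t := fun t => by
    rw [← intervalIntegral.integral_mul_const]
    simp only [mul_assoc, mul_comm (φ t)]
  simp only [hcomm]
  ring

theorem norm_fcoeff_quadrature_error_le {a : ℝ → ℝ → ℂ} (ha : IsSmoothBiperiodic a) {p r : ℝ}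
    (hr : 1 / 2 < r) : ∃ C, 0 ≤ C ∧ ∀ N : ℕ, 0 < N → ∀ φ : ℝ → ℂ, Continuous φ →
      Function.Periodic φ (2 * π) →
      (Summable fun n : ℤ => (freqWeight n ^ r * ‖fcoeff φ n‖) ^ 2) → ∀ m : ℤ,
      ‖fcoeff (fun s => trapErr N fun t => a s t * φ t) m‖ ≤
        C * ((N : ℝ) ^ (-r) * sobNormF r φ) * freqWeight m ^ (-p) := by
  obtain ⟨C, hC0, hC⟩ := ha.exists_norm_kernelCoeff_le_rpow p (r + 2)
  set K := 2 * π * √(∑' l : ℤ, |(l : ℝ)| ^ (-(2 * r))) with hK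
  set Z := ∑' n : ℤ, freqWeight n ^ (-2 : ℝ) with hZ
  have hZs : Summable fun n : ℤ => freqWeight n ^ (-2 : ℝ) := summable_freqWeight_rpow one_lt_two
  have hw : ∀ (n : ℤ) (s : ℝ), 0 < freqWeight n ^ s := fun n s =>
    Real.rpow_pos_of_pos (freqWeight_pos n) s
  have hZ0 : 0 ≤ Z := tsum_nonneg fun n => (hw n _).le
  refine ⟨C * K * Z, by positivity, fun N hN φ hφ hper hs m => ?_⟩
  rw [fcoeff_quadrature_error ha.continuous hφ]
  set b : ℝ → ℂ := fun t => fcoeff (fun s => a s t) m with hb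
  set X := (N : ℝ) ^ (-r) * sobNormF r φ with hX
  have hX0 : 0 ≤ X := mul_nonneg (by positivity) (Real.sqrt_nonneg _)
  have hbs : Summable fun j => ‖fcoeff b j‖ := by
    refine Summable.of_nonneg_of_le (fun j => norm_nonneg _) (hC m) ?_
    exact ((summable_freqWeight_rpow (by linarith)).mul_left _).mul_left _
  have hφs := summable_norm_of_summable_sobolev hr hs
  have hφb : ∀ t, ‖φ t‖ ≤ ∑' k, ‖fcoeff φ k‖ := fun t => by
    rw [← (hasSum_fcoeff_mul_trigExp hφ hper hφs.of_norm t).tsum_eq]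
    exact tsum_of_norm_bounded hφs.hasSum fun k => by rw [norm_mul, norm_trigExp, mul_one]
  have hbper : Function.Periodic b (2 * π) := fun t => by
    simp only [hb, ha.periodic_right]
  have hE := hasSum_trapErr N (F := fun j t => fcoeff b j * (trigExp j t * φ t))
    (f := fun t => b t * φ t) (fun j => by fun_prop) (hbs.mul_right (∑' k, ‖fcoeff φ k‖))
    (fun j t => by
      rw [norm_mul, norm_mul, norm_trigExp, one_mul]
      exact mul_le_mul_of_nonneg_left (hφb t) (norm_nonneg _))
    (fun t => by
      simp_rw [← mul_assoc]
      exact (hasSum_fcoeff_mul_trigExp (continuous_fcoeff ha.continuous m) hbper hbs.of_norm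
        t).mul_right _)
  rw [← hE.tsum_eq]
  refine tsum_of_norm_bounded (g := fun j => C * K * X * freqWeight m ^ (-p) *
    freqWeight j ^ (-2 : ℝ)) ?_ fun j => ?_
  · rw [show C * K * Z * X * freqWeight m ^ (-p) = C * K * X * freqWeight m ^ (-p) * Z by ring]
    exact hZs.hasSum.mul_left _
  · rw [trapErr_const_mul, norm_mul]
    have h1 := norm_trapErr_trigExp_mul_le hr hN hφ hper hs j
    calc ‖fcoeff b j‖ * ‖trapErr N fun t => trigExp j t * φ t‖
        ≤ C * (freqWeight m ^ (-p) * freqWeight j ^ (-(r + 2))) * (K * freqWeight j ^ r * X) :=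
          mul_le_mul (hC m j) h1 (norm_nonneg _)
            (mul_nonneg hC0 (mul_nonneg (hw _ _).le (hw _ _).le))
      _ = C * K * X * freqWeight m ^ (-p) * (freqWeight j ^ (-(r + 2)) * freqWeight j ^ r) := by
          ring
      _ = _ := by
          rw [← Real.rpow_add (freqWeight_pos j)]
          ring_nf

/-- quadrature error for smooth kernels: with
`Ψ₀φ(s) = ∫₀^{2π} a(s,t)φ(t)dt` and its trapezoidal-rule approximation
`Ψ₀,Nφ(s) = (π/N) Σ_j a(s, jπ/N)φ(jπ/N)`, for `p ≥ 0` and `p + q ≥ 1` (with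
`p + q > 1/2`), `‖(Ψ₀ - Ψ₀,N)φ‖_p ≤ C N^{-p-q} ‖φ‖_{p+q}`. -/
theorem quadrature_error_smooth_kernel (a : ℝ → ℝ → ℂ)
    (ha : ContDiff ℝ (⊤ : ℕ∞) (fun st : ℝ × ℝ => a st.1 st.2))
    (hper₁ : ∀ s t : ℝ, a (s + 2 * π) t = a s t)
    (hper₂ : ∀ s t : ℝ, a s (t + 2 * π) = a s t)
    (p q : ℝ) (hp : 0 ≤ p) (hpq : 1 ≤ p + q) (hpq' : 1 / 2 < p + q) :
    ∃ C > (0:ℝ), ∀ N : ℕ, 0 < N → ∀ φ : ℝ → ℂ, Continuous φ →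
      Function.Periodic φ (2 * π) →
      Summable (fun n : {n : ℤ // n ≠ 0} =>
        |(n.1 : ℝ)| ^ (2 * (p + q)) * ‖fcoeff φ n.1‖ ^ 2) →
      sobNormF p (fun s =>
          (∫ t in (0:ℝ)..(2 * π), a s t * φ t) -
            ((π / N : ℝ) : ℂ) * ∑ j ∈ Finset.range (2 * N), a s (j * π / N) * φ (j * π / N)) ≤
        C * (N : ℝ) ^ (-(p + q)) * sobNormF (p + q) φ := by
  have ha' : IsSmoothBiperiodic a := ⟨ha, hper₁, hper₂⟩
  obtain ⟨C, hC0, hC⟩ := norm_fcoeff_quadrature_error_le ha' (p := p + 1) hpq'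
  set Y := √(∑' n : ℤ, freqWeight n ^ (-2 : ℝ))
  have hY : 0 ≤ Y := Real.sqrt_nonneg _
  refine ⟨C * Y + 1, by positivity, fun N hN φ hφ hper hs => ?_⟩
  have hs' := summable_freqWeight_mul_sq hs
  have hX0 : 0 ≤ (N : ℝ) ^ (-(p + q)) * sobNormF (p + q) φ :=
    mul_nonneg (by positivity) (Real.sqrt_nonneg _)
  refine (sobNorm_le_of_norm_le (mul_nonneg hC0 hX0) (hC N hN φ hφ hper hs')).trans ?_
  linarith
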